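/- Let π = ⟨x₁,…,x_{2g} | [x₁,x₂]⋯[x_{2g−1},x_{2g}] = 1⟩ with g ≥ 2, let F be the subgroup of π generated by T = {x₃,…,x_{2g}}, and let G be the normal closure of F in π. Then F is free on T, and G is the internal free product of the conjugate subgroups F^{x₁^{k₁} x₂^{k₂}} over all (k₁,k₂) ∈ ℤ². -/

import Mathlib

/-- `S` is a free basis of the subgroup `H` of `G`. -/
def IsFreeBasis {G : Type*} [Group G] (S : Set G) (H : Subgroup G) : Prop :=
  Function.Injective (FreeGroup.lift ((↑) : S → G)) ∧
    (FreeGroup.lift ((↑) : S → G)).range = H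

/-- The surface relator `[x₁,x₂]⋯[x_{2g-1},x_{2g}]` (with `[a,b] = a⁻¹b⁻¹ab`). -/
def surfRel (g : ℕ) : FreeGroup (Fin (2 * g)) :=
  ((List.finRange g).map fun i : Fin g =>
    (FreeGroup.of (⟨2 * i, by have := i.isLt; omega⟩ : Fin (2 * g)))⁻¹ *
      (FreeGroup.of (⟨2 * i + 1, by have := i.isLt; omega⟩ : Fin (2 * g)))⁻¹ *
      FreeGroup.of (⟨2 * i, by have := i.isLt; omega⟩ : Fin (2 * g)) *
      FreeGroup.of (⟨2 * i + 1, by have := i.isLt; omega⟩ : Fin (2 * g))).prod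

/-- The genus-`g` surface group. -/
def SurfaceGroup (g : ℕ) : Type :=
  PresentedGroup {surfRel g}

instance (g : ℕ) : Group (SurfaceGroup g) :=
  QuotientGroup.Quotient.group _

/-- The generators of the surface group. -/
def xgen {g : ℕ} (i : Fin (2 * g)) : SurfaceGroup g :=
  PresentedGroup.of i

/-- The generators `x₃, …, x_{2g}` (0-indexed: indices `≥ 2`). -/
def genSet (g : ℕ) : Set (SurfaceGroup g) :=
  {y | ∃ i : Fin (2 * g), 2 ≤ (i : ℕ) ∧ y = xgen i}

/-- The subgroup `F` generated by `x₃, …, x_{2g}`. -/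
def Fsub (g : ℕ) : Subgroup (SurfaceGroup g) :=
  Subgroup.closure (genSet g)

/-- The conjugate subgroup `F^{x₁^{k₁} x₂^{k₂}} = (x₁^{k₁}x₂^{k₂})⁻¹ F (x₁^{k₁}x₂^{k₂})`. -/
def Fconj (g : ℕ) (h : 1 ≤ g) (k : ℤ × ℤ) : Subgroup (SurfaceGroup g) :=
  (Fsub g).map
    (MulAut.conj
      ((xgen (⟨0, by omega⟩ : Fin (2 * g)) ^ k.1 *
          xgen (⟨1, by omega⟩ : Fin (2 * g)) ^ k.2)⁻¹)).toMonoidHom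

section construction
variable {ι : Type}

def shE (ι : Type) : (ι × ℤ × ℤ) ≃ (ι × ℤ × ℤ) where
  toFun p := (p.1, p.2.1, p.2.2 - 1)
  invFun p := (p.1, p.2.1, p.2.2 + 1)
  left_inv p := by simp
  right_inv p := by simp

def shA (ι : Type) : MulAut (FreeGroup (ι × ℤ × ℤ)) := FreeGroup.freeGroupCongr (shE ι)

lemma shA_of (i : ι) (k l : ℤ) :
    shA ι (FreeGroup.of (i, k, l)) = FreeGroup.of (i, k, l - 1) := by
  simp [shA, shE]

lemma shA_inv_of (i : ι) (k l : ℤ) :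
    (shA ι)⁻¹ (FreeGroup.of (i, k, l)) = FreeGroup.of (i, k, l + 1) := by
  rw [MulAut.inv_apply, MulEquiv.symm_apply_eq, shA_of]; simp

lemma shA_zpow_of (m : ℤ) (i : ι) (k l : ℤ) :
    ((shA ι) ^ m) (FreeGroup.of (i, k, l)) = FreeGroup.of (i, k, l - m) := by
  induction m generalizing l with
  | zero => simp
  | succ n ih => rw [zpow_add_one, MulAut.mul_apply, shA_of, ih]; congr 3; ring
  | pred n ih => rw [zpow_sub_one, MulAut.mul_apply, shA_inv_of, ih]; congr 3; ring

abbrev KK (ι : Type) := FreeGroup (ι × ℤ × ℤ) ⋊[zpowersHom _ (shA ι)] Multiplicative ℤ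

def bK (ι : Type) : KK ι := SemidirectProduct.inr (Multiplicative.ofAdd 1)

def tK (i : ι) (k l : ℤ) : KK ι := SemidirectProduct.inl (FreeGroup.of (i, k, l))

lemma bK_zpow (m : ℤ) : (bK ι) ^ m = SemidirectProduct.inr (Multiplicative.ofAdd m) := by
  rw [bK, ← map_zpow, ← ofAdd_zsmul]; simp

lemma tK_conj (i : ι) (k l m : ℤ) :
    (bK ι) ^ m * tK i k l * ((bK ι) ^ m)⁻¹ = tK i k (l - m) := by
  rw [bK_zpow, tK, ← map_inv, ← SemidirectProduct.inl_aut, zpowersHom_apply, toAdd_ofAdd, shA_zpow_of]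
  rfl

def aH (s : ℤ) (c : KK ι) : KK ι →* KK ι :=
  SemidirectProduct.lift
    (FreeGroup.lift fun p : ι × ℤ × ℤ => (c ^ p.2.2)⁻¹ * tK p.1 (p.2.1 + s) 0 * c ^ p.2.2)
    (zpowersHom _ c) (by
      intro g
      ext ⟨i, k, l⟩ : 1
      obtain ⟨m, rfl⟩ := Multiplicative.ofAdd.surjective g
      simp only [MonoidHom.comp_apply, MulEquiv.coe_toMonoidHom, zpowersHom_apply, toAdd_ofAdd,
        shA_zpow_of, FreeGroup.lift_apply_of, MulAut.conj_apply]
      rw [zpow_sub]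
      group)

lemma aH_b (s : ℤ) (c : KK ι) : aH s c (bK ι) = c := by
  simp [aH, bK]

lemma aH_t (s : ℤ) (c : KK ι) (i : ι) (k l : ℤ) :
    aH s c (tK i k l) = (c ^ l)⁻¹ * tK i (k + s) 0 * c ^ l := by
  simp [aH, tK]

def jK (k : ℤ) : FreeGroup ι →* KK ι :=
  SemidirectProduct.inl.comp (FreeGroup.map fun i => (i, k, 0))

lemma jK_of (k : ℤ) (i : ι) : jK k (FreeGroup.of i) = tK i k 0 := by simp [jK, tK]

lemma aH_j (s : ℤ) (c : KK ι) (k : ℤ) (x : FreeGroup ι) : aH s c (jK k x) = jK (k + s) x := by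
  have : (aH s c).comp (jK k) = jK (k + s) := by
    ext i : 1
    simp [jK_of, aH_t]
  exact DFunLike.congr_fun this x

lemma KK_ext (f g : KK ι →* KK ι) (hb : f (bK ι) = g (bK ι)) (ht : ∀ i k, f (tK i k 0) = g (tK i k 0)) :
    f = g := by
  apply SemidirectProduct.hom_ext
  · ext ⟨i, k, l⟩ : 1
    change f (tK i k l) = g (tK i k l)
    have h := tK_conj i k 0 (-l)
    rw [zero_sub, neg_neg] at h
    rw [← h]
    simp [hb, ht]
  · apply MonoidHom.ext_mint
    exact hb

def cP (w : FreeGroup ι) : KK ι := bK ι * jK 0 w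
def cM (w : FreeGroup ι) : KK ι := bK ι * (jK (-1) w)⁻¹

def aA (w : FreeGroup ι) : MulAut (KK ι) :=
  MonoidHom.toMulEquiv (aH 1 (cP w)) (aH (-1) (cM w))
    (by
      apply KK_ext
      · simp only [MonoidHom.comp_apply, aH_b, cP, map_mul, aH_j, cM]
        simp
      · intro i k
        simp [aH_t])
    (by
      apply KK_ext
      · simp only [MonoidHom.comp_apply, aH_b, cM, map_mul, map_inv, aH_j, cP]
        simp
      · intro i k
        simp [aH_t])

lemma aA_apply (w : FreeGroup ι) (x : KK ι) : aA w x = aH 1 (cP w) x := rfl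
lemma aA_inv_apply (w : FreeGroup ι) (x : KK ι) : (aA w)⁻¹ x = aH (-1) (cM w) x := rfl

lemma aA_zpow_t (w : FreeGroup ι) (m : ℤ) (i : ι) (k : ℤ) :
    ((aA w) ^ m) (tK i k 0) = tK i (k + m) 0 := by
  induction m generalizing k with
  | zero => simp
  | succ n ih =>
    rw [zpow_add_one, MulAut.mul_apply, aA_apply, aH_t]; simp only [zpow_zero, inv_one, one_mul, mul_one]
    rw [ih]; congr 1; ring
  | pred n ih =>
    rw [zpow_sub_one, MulAut.mul_apply, aA_inv_apply, aH_t]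
    simp only [zpow_zero, inv_one, one_mul, mul_one]
    rw [ih]; congr 1; ring

theorem exists_model (w : FreeGroup ι) : ∃ (Γ : Type) (_ : Group Γ) (a b : Γ)
    (j : FreeGroup (ι × ℤ × ℤ) →* Γ), Function.Injective j ∧
    a⁻¹ * b⁻¹ * a * b * j (FreeGroup.map (fun i => (i, 0, 0)) w) = 1 ∧
    ∀ i k l, j (FreeGroup.of (i, k, l)) =
      (a ^ k * b ^ l)⁻¹ * j (FreeGroup.of (i, 0, 0)) * (a ^ k * b ^ l) := by
  let Γ := KK ι ⋊[zpowersHom _ (aA w)⁻¹] Multiplicative ℤ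
  let I : KK ι →* Γ := SemidirectProduct.inl
  let a : Γ := SemidirectProduct.inr (Multiplicative.ofAdd 1)
  have ha : ∀ (m : ℤ) (x : KK ι), (a ^ m)⁻¹ * I x * a ^ m = I ((aA w ^ m) x) := by
    intro m x
    have h1 : a ^ m = SemidirectProduct.inr (Multiplicative.ofAdd m) := by
      change (SemidirectProduct.inr _) ^ m = _
      rw [← map_zpow, ← ofAdd_zsmul]; simp
    have := SemidirectProduct.inl_aut_inv (φ := zpowersHom _ (aA w)⁻¹) (Multiplicative.ofAdd m) x
    rw [h1, ← map_inv]
    rw [← this]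
    simp [I]
  refine ⟨Γ, inferInstance, a, I (bK ι), I.comp SemidirectProduct.inl, ?_, ?_, ?_⟩
  · exact SemidirectProduct.inl_injective.comp SemidirectProduct.inl_injective
  · have h := ha 1 (bK ι)
    simp only [zpow_one, aA_apply, aH_b, cP] at h
    have h2 : a⁻¹ * (I (bK ι))⁻¹ * a = (I (bK ι * jK 0 w))⁻¹ := by rw [← h]; group
    rw [h2, map_mul]
    change _ * I (jK 0 w) = 1
    group
  · intro i k l
    change I (tK i k l) = _ * I (tK i 0 0) * _
    have h := ha k (tK i 0 0)
    rw [aA_zpow_t, zero_add] at h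
    have h3 := tK_conj i k 0 (-l)
    rw [zero_sub, neg_neg] at h3
    rw [← h3, map_mul, map_mul, ← h]
    simp only [map_inv, map_zpow]
    group
end construction

lemma conjInv {H : Type*} [Group H] (x y : H) :
    (MulAut.conj x⁻¹).toMonoidHom y = x⁻¹ * y * x := by
  change x⁻¹ * y * x⁻¹⁻¹ = _
  rw [inv_inv]

def commW {g : ℕ} (i : Fin g) : FreeGroup (Fin (2 * g)) :=
  (FreeGroup.of (⟨2 * i, by have := i.isLt; omega⟩ : Fin (2 * g)))⁻¹ *
      (FreeGroup.of (⟨2 * i + 1, by have := i.isLt; omega⟩ : Fin (2 * g)))⁻¹ *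
      FreeGroup.of (⟨2 * i, by have := i.isLt; omega⟩ : Fin (2 * g)) *
      FreeGroup.of (⟨2 * i + 1, by have := i.isLt; omega⟩ : Fin (2 * g))

lemma exists_tail (g : ℕ) (hg : 1 ≤ g) : ∃ L : List (Fin g), (∀ i ∈ L, 1 ≤ (i : ℕ)) ∧
    surfRel g = commW (⟨0, hg⟩ : Fin g) * (L.map commW).prod := by
  obtain ⟨n, rfl⟩ : ∃ n, g = n + 1 := ⟨g - 1, by omega⟩
  refine ⟨(List.finRange n).map Fin.succ, ?_, ?_⟩
  · intro i hi
    obtain ⟨j, -, rfl⟩ := List.mem_map.1 hi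
    simp
  · have : surfRel (n + 1) = ((List.finRange (n + 1)).map commW).prod := rfl
    rw [this, List.finRange_succ, List.map_cons, List.prod_cons]
    rfl

/-- the conjugated generators -/
def cgen {g : ℕ} (h : 1 ≤ g) (i : Fin (2 * g)) (k l : ℤ) : SurfaceGroup g :=
  (xgen (⟨0, by omega⟩ : Fin (2 * g)) ^ k * xgen (⟨1, by omega⟩ : Fin (2 * g)) ^ l)⁻¹ *
    xgen i * (xgen (⟨0, by omega⟩ : Fin (2 * g)) ^ k * xgen (⟨1, by omega⟩ : Fin (2 * g)) ^ l)

def phiS {g : ℕ} (h : 1 ≤ g) :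
    FreeGroup ({i : Fin (2 * g) // 2 ≤ (i : ℕ)} × ℤ × ℤ) →* SurfaceGroup g :=
  FreeGroup.lift fun p => cgen h p.1.1 p.2.1 p.2.2

lemma list_hom_congr {g : ℕ} {H : Type*} [Group H] (f f' : FreeGroup (Fin (2 * g)) →* H)
    (hf : ∀ i : Fin (2 * g), 2 ≤ (i : ℕ) → f (FreeGroup.of i) = f' (FreeGroup.of i))
    (L : List (Fin g)) (hL : ∀ i ∈ L, 1 ≤ (i : ℕ)) :
    f (L.map commW).prod = f' (L.map commW).prod := by
  rw [map_list_prod, map_list_prod, List.map_map, List.map_map]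
  congr 1
  apply List.map_congr_left
  intro i hi
  have := hL i hi
  simp only [Function.comp_apply, commW, map_mul, map_inv]
  rw [hf _ (by simp; omega), hf _ (by simp; omega)]

lemma phiS_inj {g : ℕ} (h : 1 ≤ g) : Function.Injective (phiS h) := by
  obtain ⟨L, hL, hs⟩ := exists_tail g h
  obtain ⟨Γ, _, a, b, j, hj, hr, hc⟩ := exists_model (L.map (commW (g := g))).prod
  let f : Fin (2 * g) → Γ := fun i => if (i : ℕ) = 0 then a else if (i : ℕ) = 1 then b else
    j (FreeGroup.of (i, 0, 0))
  have hf2 : ∀ i : Fin (2 * g), 2 ≤ (i : ℕ) → f i = j (FreeGroup.of (i, 0, 0)) := by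
    intro i hi
    simp only [f]
    rw [if_neg (by omega), if_neg (by omega)]
  have hrel : ∀ r ∈ ({surfRel g} : Set _), FreeGroup.lift f r = 1 := by
    intro r hr'
    rw [Set.mem_singleton_iff.1 hr', hs, map_mul,
      list_hom_congr (FreeGroup.lift f) (j.comp (FreeGroup.map (fun i => (i, 0, 0)))) _ L hL]
    · rw [← hr]
      simp [commW, f]
    · intro i hi
      simp [hf2 i hi]
  let Φ : SurfaceGroup g →* Γ := PresentedGroup.toGroup hrel
  have hΦ : ∀ i, Φ (xgen i) = f i := fun i => PresentedGroup.toGroup.of hrel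
  have key : Φ.comp (phiS h) = j.comp (FreeGroup.map fun p => (p.1.1, p.2)) := by
    ext ⟨⟨i, hi⟩, k, l⟩ : 1
    simp only [MonoidHom.comp_apply, phiS, FreeGroup.lift_apply_of, cgen, map_mul, map_inv, map_zpow, hΦ,
      FreeGroup.map.of]
    rw [hc i k l, hf2 i hi]
    simp [f]
  have hinj : Function.Injective (Φ.comp (phiS h)) := by
    rw [key]
    refine hj.comp (FreeGroup.map_injective ?_)
    rintro ⟨⟨i, hi⟩, k⟩ ⟨⟨i', hi'⟩, k'⟩ h
    simpa using h
  exact Function.Injective.of_comp (f := Φ) hinj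

lemma surf_rel {g : ℕ} (h : 1 ≤ g) : ∃ w ∈ Fsub g,
    (xgen (⟨0, by omega⟩ : Fin (2 * g)))⁻¹ * (xgen (⟨1, by omega⟩ : Fin (2 * g)))⁻¹ *
    xgen (⟨0, by omega⟩ : Fin (2 * g)) * xgen (⟨1, by omega⟩ : Fin (2 * g)) * w = 1 := by
  obtain ⟨L, hL, hs⟩ := exists_tail g h
  let p : FreeGroup (Fin (2 * g)) →* SurfaceGroup g := PresentedGroup.mk {surfRel g}
  have hp : ∀ i, p (FreeGroup.of i) = xgen i := fun i => rfl
  refine ⟨p (L.map commW).prod, ?_, ?_⟩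
  · rw [map_list_prod]
    apply Subgroup.list_prod_mem
    intro x hx
    rw [List.map_map] at hx
    obtain ⟨i, hi, rfl⟩ := List.mem_map.1 hx
    have := hL i hi
    have hm : ∀ i : Fin (2 * g), 2 ≤ (i : ℕ) → xgen i ∈ Fsub g := fun i hi =>
      Subgroup.subset_closure ⟨i, hi, rfl⟩
    simp only [Function.comp_apply, commW, map_mul, map_inv, hp]
    refine mul_mem (mul_mem (mul_mem (inv_mem (hm _ ?_)) (inv_mem (hm _ ?_))) (hm _ ?_)) (hm _ ?_) <;>
    · simp; omega
  · have h1 : p (surfRel g) = 1 := PresentedGroup.one_of_mem (Set.mem_singleton _)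
    rw [hs, map_mul] at h1
    rw [← h1]
    simp [commW, hp]

lemma Fconj_le {g : ℕ} (h : 1 ≤ g) (k : ℤ × ℤ) : Fconj g h k ≤ (phiS h).range := by
  rw [Fconj, Subgroup.map_le_iff_le_comap, Fsub, Subgroup.closure_le]
  rintro _ ⟨i, hi, rfl⟩
  refine ⟨FreeGroup.of (⟨i, hi⟩, k), ?_⟩
  rw [conjInv]
  simp [phiS, cgen]

lemma cgen_mem {g : ℕ} (h : 1 ≤ g) (i : Fin (2 * g)) (hi : 2 ≤ (i : ℕ)) (k l : ℤ) :
    cgen h i k l ∈ (phiS h).range := ⟨FreeGroup.of (⟨i, hi⟩, k, l), by simp [phiS]⟩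

lemma mem_norm {g : ℕ} (h : 1 ≤ g) (x : SurfaceGroup g)
    (h1 : ∀ i : Fin (2 * g), 2 ≤ (i : ℕ) → ∀ k l, x⁻¹ * cgen h i k l * x ∈ (phiS h).range)
    (h2 : ∀ i : Fin (2 * g), 2 ≤ (i : ℕ) → ∀ k l, x * cgen h i k l * x⁻¹ ∈ (phiS h).range) :
    x ∈ Subgroup.normalizer ((phiS h).range : Set (SurfaceGroup g)) := by
  have A : ∀ y : SurfaceGroup g,
      (∀ i : Fin (2 * g), 2 ≤ (i : ℕ) → ∀ k l, y * cgen h i k l * y⁻¹ ∈ (phiS h).range) →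
      ∀ z ∈ (phiS h).range, y * z * y⁻¹ ∈ (phiS h).range := by
    intro y hy z hz
    have : (phiS h).range ≤ (phiS h).range.comap (MulAut.conj y).toMonoidHom := by
      conv_lhs => rw [phiS]
      rw [FreeGroup.range_lift_eq_closure, Subgroup.closure_le]
      rintro _ ⟨⟨⟨i, hi⟩, k, l⟩, rfl⟩
      simpa using hy i hi k l
    simpa using this hz
  rw [Subgroup.mem_normalizer_iff]
  intro z
  refine ⟨A x h2 z, fun hz => ?_⟩
  have := A x⁻¹ (by simpa using h1) _ hz
  simpa [mul_assoc] using this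

lemma zpow_norm {H : Type*} [Group H] (R : Subgroup H) (b r : H)
    (hb : b ∈ Subgroup.normalizer (R : Set H)) (hr : r ∈ R) (l : ℤ) : ∃ r' ∈ R, (b * r) ^ l = b ^ l * r' := by
  refine ⟨(b ^ l)⁻¹ * (b * r) ^ l, ?_, by group⟩
  let N := Subgroup.normalizer (R : Set H)
  let b' : N := ⟨b, hb⟩
  let r' : N := ⟨r, Subgroup.le_normalizer hr⟩
  have h1 : ((b' * r' : N) : N ⧸ R.subgroupOf N) = (b' : N ⧸ R.subgroupOf N) := by
    symm
    rw [QuotientGroup.eq]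
    simpa [Subgroup.mem_subgroupOf, r'] using hr
  have h2 : ((b' ^ l : N) : N ⧸ R.subgroupOf N) = (((b' * r') ^ l : N) : N ⧸ R.subgroupOf N) := by
    rw [QuotientGroup.mk_zpow, QuotientGroup.mk_zpow, h1]
  rw [QuotientGroup.eq, Subgroup.mem_subgroupOf] at h2
  simpa [b', r'] using h2

lemma range_normal {g : ℕ} (h : 1 ≤ g) : (phiS h).range.Normal := by
  obtain ⟨w, hw, hrel⟩ := surf_rel h
  set a := xgen (⟨0, by omega⟩ : Fin (2 * g)) with ha
  set b := xgen (⟨1, by omega⟩ : Fin (2 * g)) with hb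
  have hbN : b ∈ Subgroup.normalizer ((phiS h).range : Set (SurfaceGroup g)) := by
    apply mem_norm
    · intro i hi k l
      have := cgen_mem h i hi k (l + 1)
      rw [cgen, ← ha, ← hb] at this
      rw [cgen, ← ha, ← hb]
      convert this using 1
      group
    · intro i hi k l
      have := cgen_mem h i hi k (l - 1)
      rw [cgen, ← ha, ← hb] at this
      rw [cgen, ← ha, ← hb]
      convert this using 1
      group
  have hFc : ∀ k : ℤ, (a ^ k)⁻¹ * w * a ^ k ∈ (phiS h).range := by
    intro k
    apply Fconj_le h (k, 0)
    exact ⟨w, hw, by rw [conjInv]; simp [ha]⟩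
  have hc : a⁻¹ * b * a = b * w := by
    have e : b * w = b * (a⁻¹ * b⁻¹ * a * b)⁻¹ := by rw [← eq_inv_of_mul_eq_one_right hrel]
    rw [e]; group
  have hc' : a * b * a⁻¹ = b * (a * w * a⁻¹)⁻¹ := by
    have e : a * (a⁻¹ * b * a) * a⁻¹ = a * (b * w) * a⁻¹ := by rw [hc]
    have e2 : b = a * b * a⁻¹ * (a * w * a⁻¹) := by
      calc b = a * (a⁻¹ * b * a) * a⁻¹ := by group
        _ = _ := e
        _ = _ := by group
    rw [eq_mul_inv_iff_mul_eq]; exact e2.symm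
  have haN : a ∈ Subgroup.normalizer ((phiS h).range : Set (SurfaceGroup g)) := by
    have conjz : ∀ (x y : SurfaceGroup g) (l : ℤ), (x * y * x⁻¹) ^ l = x * y ^ l * x⁻¹ :=
      fun x y l => conj_zpow
    apply mem_norm
    · intro i hi k l
      obtain ⟨r, hr, e⟩ := zpow_norm (phiS h).range b w hbN (by simpa using hFc 0) l
      rw [← hc] at e
      have e' : a⁻¹ * b ^ l * a = b ^ l * r := by
        rw [← e]; simpa using (conjz a⁻¹ b l).symm
      have := mul_mem (mul_mem (inv_mem hr) (cgen_mem h i hi (k + 1) l)) hr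
      rw [cgen, ← ha, ← hb] at this
      rw [cgen, ← ha, ← hb]
      convert this using 1
      have : r = (b ^ l)⁻¹ * (a⁻¹ * b ^ l * a) := by rw [e']; group
      rw [this]; group
    · intro i hi k l
      obtain ⟨r, hr, e⟩ := zpow_norm (phiS h).range b (a * w * a⁻¹)⁻¹ hbN
        (inv_mem (by simpa using hFc (-1))) l
      rw [← hc', conjz] at e
      have := mul_mem (mul_mem (inv_mem hr) (cgen_mem h i hi (k - 1) l)) hr
      rw [cgen, ← ha, ← hb] at this
      rw [cgen, ← ha, ← hb]
      convert this using 1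
      have : r = (b ^ l)⁻¹ * (a * b ^ l * a⁻¹) := by rw [e]; group
      rw [this]; group
  rw [← Subgroup.normalizer_eq_top_iff, eq_top_iff]
  have htop : Subgroup.closure (Set.range (xgen (g := g))) = ⊤ :=
    PresentedGroup.closure_range_of {surfRel g}
  rw [← htop, Subgroup.closure_le]
  rintro _ ⟨i, rfl⟩
  by_cases h0 : (i : ℕ) = 0
  · have : i = ⟨0, by omega⟩ := Fin.ext h0
    rw [this]; exact haN
  by_cases h1 : (i : ℕ) = 1
  · have : i = ⟨1, by omega⟩ := Fin.ext h1
    rw [this]; exact hbN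
  · apply Subgroup.le_normalizer
    simpa [cgen] using cgen_mem h i (by omega) 0 0

/-- For `g ≥ 2`: the subgroup `F` of the surface group generated by `T = {x₃,…,x_{2g}}` is
free on `T`, and the normal closure `G` of `F` is the internal free product of the
conjugates `F^{x₁^{k₁}x₂^{k₂}}`, `(k₁,k₂) ∈ ℤ²`. -/
theorem stmt15 (g : ℕ) (hg : 2 ≤ g) :
    IsFreeBasis (genSet g) (Fsub g) ∧
    Function.Injective
      (Monoid.CoprodI.lift fun k : ℤ × ℤ => (Fconj g (by omega) k).subtype) ∧
    (Monoid.CoprodI.lift fun k : ℤ × ℤ => (Fconj g (by omega) k).subtype).range =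
      Subgroup.normalClosure (Fsub g : Set (SurfaceGroup g)) := by
  have h1 : 1 ≤ g := by omega
  refine ⟨⟨?_, ?_⟩, ?_⟩
  · have hx : ∀ y : genSet g, ∃ i : Fin (2 * g), 2 ≤ (i : ℕ) ∧ (y : SurfaceGroup g) = xgen i := fun y => y.2
    choose c hc2 hc using hx
    have : FreeGroup.lift ((↑) : genSet g → SurfaceGroup g) =
        (phiS h1).comp (FreeGroup.map fun y => (⟨c y, hc2 y⟩, 0, 0)) := by
      ext y : 1
      simp [phiS, cgen, ← hc]
    rw [this]
    refine (phiS_inj h1).comp (FreeGroup.map_injective ?_)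
    intro y z hyz
    have : c y = c z := by simpa using hyz
    apply Subtype.ext
    rw [hc, hc, this]
  · rw [FreeGroup.range_lift_eq_closure, Subtype.range_coe, Fsub]
  let Λ := Monoid.CoprodI.lift fun k : ℤ × ℤ => (Fconj g h1 k).subtype
  have hmem : ∀ (i : Fin (2 * g)), 2 ≤ (i : ℕ) → ∀ k : ℤ × ℤ, cgen h1 i k.1 k.2 ∈ Fconj g h1 k := by
    intro i hi k
    exact ⟨xgen i, Subgroup.subset_closure ⟨i, hi, rfl⟩, by rw [conjInv, cgen]⟩
  let ψ : FreeGroup ({i : Fin (2 * g) // 2 ≤ (i : ℕ)} × ℤ × ℤ) →*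
      Monoid.CoprodI fun k : ℤ × ℤ => Fconj g h1 k :=
    FreeGroup.lift fun p => Monoid.CoprodI.of (i := p.2) ⟨cgen h1 p.1.1 p.2.1 p.2.2, hmem p.1.1 p.1.2 p.2⟩
  have hψ : Λ.comp ψ = phiS h1 := by
    ext p : 1
    simp [Λ, ψ, phiS]
  have hsurj : Function.Surjective ψ := by
    intro x
    change x ∈ ψ.range
    induction x using Monoid.CoprodI.induction_on with
    | one => exact one_mem _
    | mul x y hx hy => exact mul_mem hx hy
    | of k x =>
      obtain ⟨x, y, hy, rfl⟩ := x
      have hk : ∀ y (hy : y ∈ Fsub g), Monoid.CoprodI.of (M := fun k : ℤ × ℤ => Fconj g h1 k) (i := k)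
          ⟨_, Subgroup.mem_map_of_mem _ hy⟩ ∈ ψ.range := by
        intro y hy
        induction hy using Subgroup.closure_induction with
        | mem y hy =>
          obtain ⟨i, hi, rfl⟩ := hy
          refine ⟨FreeGroup.of (⟨i, hi⟩, k), ?_⟩
          simp only [ψ, FreeGroup.lift_apply_of]
          congr 1
          apply Subtype.ext
          change cgen h1 i k.1 k.2 = (MulAut.conj _⁻¹).toMonoidHom (xgen i)
          rw [conjInv, cgen]
        | one =>
          convert one_mem ψ.range
          rw [← map_one (Monoid.CoprodI.of (M := fun k : ℤ × ℤ => Fconj g h1 k) (i := k))]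
          congr 1
          apply Subtype.ext
          simp
        | mul u v hu hv iu iv =>
          convert mul_mem iu iv
          rw [← map_mul]
          congr 1
          apply Subtype.ext
          simp
        | inv u hu iu =>
          convert inv_mem iu
          rw [← map_inv]
          congr 1
          apply Subtype.ext
          simp
      exact hk y hy
  have hrange : Λ.range = (phiS h1).range := by
    rw [← hψ, MonoidHom.range_comp, MonoidHom.range_eq_top.2 hsurj, MonoidHom.range_eq_map]
  refine ⟨?_, ?_⟩
  · change Function.Injective Λ
    intro x y hxy
    obtain ⟨x, rfl⟩ := hsurj x
    obtain ⟨y, rfl⟩ := hsurj y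
    have : phiS h1 x = phiS h1 y := by rw [← hψ]; exact hxy
    rw [phiS_inj h1 this]
  · change Λ.range = _
    rw [hrange]
    apply le_antisymm
    · rw [phiS, FreeGroup.range_lift_eq_closure, Subgroup.closure_le]
      rintro _ ⟨⟨⟨i, hi⟩, k, l⟩, rfl⟩
      have h2 : xgen i ∈ Subgroup.normalClosure (Fsub g : Set (SurfaceGroup g)) :=
        Subgroup.subset_normalClosure (Subgroup.subset_closure ⟨i, hi, rfl⟩)
      have := Subgroup.normalClosure_normal.conj_mem _ h2 (xgen (⟨0, by omega⟩ : Fin (2 * g)) ^ k *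
          xgen (⟨1, by omega⟩ : Fin (2 * g)) ^ l)⁻¹
      rw [inv_inv] at this
      exact this
    · have := range_normal h1
      apply Subgroup.normalClosure_le_normal
      intro y hy
      apply Fconj_le h1 (0, 0)
      exact ⟨y, hy, by simp⟩
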